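/- Let G be a finite simple connected graph on the vertex set {1,…,d} with n edges. Then the normality condition holds for the centrally symmetric configuration (A_{G̃})^± of the matrix A_{G̃}: ℤ_{≥0}(A_{G̃})^± = ℤ(A_{G̃})^± ∩ ℚ_{≥0}(A_{G̃})^±, i.e. the toric ring K[(A_{G̃})^±] is normal. -/

import Mathlib

/-- The subgroup `ℤA` of `ℤ^d` generated by the columns of an integer matrix. -/
def colLattice {d n : ℕ} (A : Matrix (Fin d) (Fin n) ℤ) : AddSubgroup (Fin d → ℤ) :=
  AddSubgroup.closure (Set.range fun j i => A i j)

/-- The submonoid `ℤ_{≥0}A` of `ℤ^d` generated by the columns of an integer matrix. -/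
def colMonoid {d n : ℕ} (A : Matrix (Fin d) (Fin n) ℤ) : AddSubmonoid (Fin d → ℤ) :=
  AddSubmonoid.closure (Set.range fun j i => A i j)

/-- The set `ℚ_{≥0}A` of lattice points that are nonnegative rational combinations of
the columns of `A`. -/
def colQNonneg {d n : ℕ} (A : Matrix (Fin d) (Fin n) ℤ) : Set (Fin d → ℤ) :=
  {x | ∃ r : Fin n → ℚ, (∀ j, 0 ≤ r j) ∧ ∀ i, (x i : ℚ) = ∑ j, r j * (A i j : ℚ)}

/-- The normality condition `ℤ_{≥0}A = ℤA ∩ ℚ_{≥0}A` for the toric ring `K[A]`. -/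
def IsNormalConfig {d n : ℕ} (A : Matrix (Fin d) (Fin n) ℤ) : Prop :=
  (colMonoid A : Set (Fin d → ℤ)) = (colLattice A : Set (Fin d → ℤ)) ∩ colQNonneg A

/-- The centrally symmetric configuration `A^± ∈ ℤ^{(d+1)×(2n+1)}` of `A ∈ ℤ^{d×n}`:
its columns are `(0,…,0,1)ᵀ` (column `0`), `(a_j, 1)ᵀ` (columns `1,…,n`) and
`(−a_j, 1)ᵀ` (columns `n+1,…,2n`). -/
def csc {d n : ℕ} (A : Matrix (Fin d) (Fin n) ℤ) :
    Matrix (Fin (d + 1)) (Fin (2 * n + 1)) ℤ := fun i j =>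
  if hi : (i : ℕ) < d then
    if h0 : (j : ℕ) = 0 then 0
    else if hj : (j : ℕ) ≤ n then A ⟨i, hi⟩ ⟨(j : ℕ) - 1, by omega⟩
    else - A ⟨i, hi⟩ ⟨(j : ℕ) - n - 1, by have := j.isLt; omega⟩
  else 1

/-- The matrix `A_{G̃} ∈ ℤ^{d×n}` of a graph with edges `{v k, w k}` (`v k < w k`):
its `k`-th column is `μ(e_k) = 𝐞_{v k} − 𝐞_{w k}`. -/
def dirEdgeMatrix {d n : ℕ} (v w : Fin n → Fin d) : Matrix (Fin d) (Fin n) ℤ :=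
  Matrix.of fun i k => (if i = v k then (1 : ℤ) else 0) - (if i = w k then 1 else 0)

/-- The integers as a subring of `ℚ`. -/
abbrev intRat : Subring ℚ := (Int.castRingHom ℚ).range

section Incidence

variable {d n : ℕ} {v w : Fin n → Fin d}

lemma dirEdgeMatrix_ne_zero {i : Fin d} {k : Fin n} (h : dirEdgeMatrix v w i k ≠ 0) :
    (i = v k ∨ i = w k) ∧ (dirEdgeMatrix v w i k = 1 ∨ dirEdgeMatrix v w i k = -1) := by
  simp only [dirEdgeMatrix, Matrix.of_apply] at h ⊢
  split_ifs at h ⊢ <;> simp_all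

lemma dirEdgeMatrix_sum (k : Fin n) : ∑ i, dirEdgeMatrix v w i k = 0 := by
  simp [dirEdgeMatrix]

/-- A nonempty set of edges without vertices of degree one carries a nonzero circulation. -/
lemma exists_circulation (S : Finset (Fin n)) (hS : S.Nonempty)
    (hne : ∀ k, v k ≠ w k)
    (hdeg : ∀ i, (S.filter fun k => dirEdgeMatrix v w i k ≠ 0).card ≠ 1) :
    ∃ z : Fin n → ℚ, z ≠ 0 ∧ (∀ k ∉ S, z k = 0) ∧
      ∀ i, ∑ k, (dirEdgeMatrix v w i k : ℚ) * z k = 0 := by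
  classical
  set A := dirEdgeMatrix v w with hA
  let U : Finset (Fin d) := Finset.univ.filter fun i => ∃ k ∈ S, A i k ≠ 0
  have hmemU {i k} (hk : k ∈ S) (h : A i k ≠ 0) : i ∈ U := by
    simp only [U, Finset.mem_filter, Finset.mem_univ, true_and]; exact ⟨k, hk, h⟩
  have hcard : U.card ≤ S.card := by
    have := Finset.card_mul_le_card_mul (s := U) (t := S) (m := 2) (n := 2)
      (fun i k => A i k ≠ 0) (fun i hi => by
        obtain ⟨k, hk, h⟩ := (Finset.mem_filter.1 hi).2
        have h1 : 0 < (S.filter fun k => A i k ≠ 0).card :=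
          Finset.card_pos.2 ⟨k, Finset.mem_filter.2 ⟨hk, h⟩⟩
        have h2 := hdeg i
        convert (show 2 ≤ (S.filter fun k => A i k ≠ 0).card by omega)
        ext
        simp [Finset.bipartiteAbove]) (fun k _ => by
        refine (Finset.card_le_card (t := {v k, w k}) fun i hi => ?_).trans Finset.card_le_two
        simp only [Finset.bipartiteBelow, Finset.mem_filter] at hi
        have := (dirEdgeMatrix_ne_zero hi.2).1
        simpa using this)
    omega
  let L : (S → ℚ) →ₗ[ℚ] (U → ℚ) :=
    Matrix.mulVecLin (Matrix.of fun (i : U) (k : S) => (A i k : ℚ))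
  have hL (y : S → ℚ) (i : U) : L y i = ∑ k : S, (A i k : ℚ) * y k := rfl
  have hnotinj : ¬ Function.Injective L := by
    intro hinj
    have hle := LinearMap.finrank_le_finrank_of_injective hinj
    simp only [Module.finrank_fintype_fun_eq_card, Fintype.card_coe] at hle
    have hsurj : Function.Surjective L :=
      (LinearMap.injective_iff_surjective_of_finrank_eq_finrank
        (by simp only [Module.finrank_fintype_fun_eq_card, Fintype.card_coe]; omega)).1 hinj
    obtain ⟨k, hk⟩ := hS
    have hvk : A (v k) k ≠ 0 := by simp [hA, dirEdgeMatrix, hne k]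
    obtain ⟨y, hy⟩ := hsurj (Pi.single ⟨v k, hmemU hk hvk⟩ 1)
    have h1 : ∑ i, L y i = 1 := by rw [hy]; simp
    have h0 : ∑ i, L y i = 0 := by
      simp only [hL]
      rw [Finset.sum_comm]
      refine Finset.sum_eq_zero fun l _ => ?_
      rw [← Finset.sum_mul, Finset.sum_coe_sort U (fun i => (A i l : ℚ)),
        Finset.sum_subset (Finset.subset_univ U), ← Int.cast_sum, hA, dirEdgeMatrix_sum]
      · simp
      · intro i _ hi
        by_contra h
        exact hi (hmemU l.2 (by exact_mod_cast h))
    linarith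
  obtain ⟨y, hy0, hy⟩ : ∃ y, L y = 0 ∧ y ≠ 0 := by
    by_contra! h
    exact hnotinj ((injective_iff_map_eq_zero L).2 h)
  have hz (f : Fin n → ℚ) :
      ∑ k, f k * (if h : k ∈ S then y ⟨k, h⟩ else 0) = ∑ k : S, f k * y k := by
    rw [← Finset.sum_subset (Finset.subset_univ S), ← Finset.sum_coe_sort S]
    · exact Finset.sum_congr rfl fun k _ => by simp
    · intro k _ hk; simp [hk]
  refine ⟨fun k => if h : k ∈ S then y ⟨k, h⟩ else 0, ?_, fun k hk => by simp [hk], fun i => ?_⟩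
  · intro h
    apply hy
    ext k
    simpa using congrFun h k
  · rw [hz]
    by_cases hi : i ∈ U
    · exact congrFun hy0 ⟨i, hi⟩
    · refine Finset.sum_eq_zero fun k _ => ?_
      have : A i k = 0 := by
        by_contra h
        exact hi (hmemU k.2 h)
      simp [this]

/-- The non-integral edges of a rational flow with integral divergence carry a circulation. -/
lemma exists_circulation_of_not_mem_intRat (hne : ∀ k, v k ≠ w k) (c : Fin n → ℚ)
    (hc : ∀ i, ∑ k, (dirEdgeMatrix v w i k : ℚ) * c k ∈ intRat)
    (hex : ∃ k, c k ∉ intRat) :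
    ∃ z : Fin n → ℚ, z ≠ 0 ∧ (∀ k, c k ∈ intRat → z k = 0) ∧
      ∀ i, ∑ k, (dirEdgeMatrix v w i k : ℚ) * z k = 0 := by
  classical
  obtain ⟨z, hz, hzS, hzA⟩ := exists_circulation (v := v) (w := w)
    (Finset.univ.filter fun k => c k ∉ intRat)
    (by obtain ⟨k, hk⟩ := hex; exact ⟨k, by simpa using hk⟩) hne (by
      intro i hi
      obtain ⟨l, hl⟩ := Finset.card_eq_one.1 hi
      have hmem := Finset.mem_singleton_self l
      rw [← hl, Finset.mem_filter, Finset.mem_filter] at hmem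
      obtain ⟨⟨-, hcl⟩, hAl⟩ := hmem
      have hsum := hc i
      rw [← Finset.add_sum_erase _ _ (Finset.mem_univ l)] at hsum
      have hrest : ∑ k ∈ Finset.univ.erase l, (dirEdgeMatrix v w i k : ℚ) * c k ∈ intRat := by
        refine Subring.sum_mem _ fun k hk => ?_
        by_cases h : dirEdgeMatrix v w i k = 0
        · simp only [h, Int.cast_zero, zero_mul]; exact Subring.zero_mem _
        · refine Subring.mul_mem _ ⟨_, rfl⟩ ?_
          by_contra hck
          refine (Finset.mem_erase.1 hk).1 (Finset.mem_singleton.1 (hl ▸ ?_))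
          simp only [Finset.mem_filter, Finset.mem_univ, true_and]
          exact ⟨hck, h⟩
      have hl' := Subring.sub_mem _ hsum hrest
      rw [add_sub_cancel_right] at hl'
      apply hcl
      rcases (dirEdgeMatrix_ne_zero hAl).2 with h | h
      · simpa only [h, Int.cast_one, one_mul] using hl'
      · have := Subring.neg_mem _ hl'
        simpa only [h, Int.cast_neg, Int.cast_one, neg_mul, one_mul, neg_neg] using this)
  exact ⟨z, hz, fun k hk => hzS k (by simpa using hk), hzA⟩

end Incidence

lemma abs_eq_of_mem_floor_ceil {a b : ℚ} (h1 : (⌊a⌋ : ℚ) ≤ b) (h2 : b ≤ ⌈a⌉) :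
    |b| = |a| + SignType.sign a * (b - a) := by
  rcases lt_trichotomy a 0 with h | rfl | h
  · have : (⌈a⌉ : ℚ) ≤ 0 := by exact_mod_cast Int.ceil_le.2 (by simpa using h.le)
    rw [abs_of_nonpos (h2.trans this), abs_of_neg h, sign_neg h]
    simp only [SignType.coe_neg_one]
    ring
  · simp at h1 h2
    simp [le_antisymm h2 h1]
  · have : (0 : ℚ) ≤ ⌊a⌋ := by exact_mod_cast Int.floor_nonneg.2 h.le
    rw [abs_of_nonneg (this.trans h1), abs_of_pos h, sign_pos h]
    simp only [SignType.coe_one]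
    ring

/-- Moving along `z` until the first non-integral coordinate of `c` becomes integral. -/
lemma exists_step {E : Type*} [Fintype E] (c z : E → ℚ) (hz : z ≠ 0)
    (hcz : ∀ k, c k ∈ intRat → z k = 0) :
    ∃ t : ℚ, ∑ k, |c k + t * z k| ≤ ∑ k, |c k| ∧
      ∃ k, c k ∉ intRat ∧ c k + t * z k ∈ intRat := by
  classical
  wlog hs : ∑ k, (SignType.sign (c k) : ℚ) * z k ≤ 0 generalizing z
  · obtain ⟨t, ht, h⟩ := this (-z) (neg_ne_zero.2 hz) (fun k hk => by simp [hcz k hk])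
      (by simp only [Pi.neg_apply, mul_neg, Finset.sum_neg_distrib]; linarith)
    exact ⟨-t, by simpa using ht, by simpa using h⟩
  let g : E → ℤ := fun k => if 0 < z k then ⌈c k⌉ else ⌊c k⌋
  let T : E → ℚ := fun k => (g k - c k) / z k
  have hT0 (k) : 0 ≤ T k := by
    simp only [T, g]
    split_ifs with h
    · exact div_nonneg (sub_nonneg.2 (Int.le_ceil _)) h.le
    · exact div_nonneg_of_nonpos (sub_nonpos.2 (Int.floor_le _)) (not_lt.1 h)
  obtain ⟨l, hl, hmin⟩ := Finset.exists_min_image (Finset.univ.filter fun k => z k ≠ 0) T (by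
    obtain ⟨k, hk⟩ := Function.ne_iff.1 hz
    exact ⟨k, by simpa using hk⟩)
  simp only [Finset.mem_filter, Finset.mem_univ, true_and] at hl hmin
  have hb (k) : (⌊c k⌋ : ℚ) ≤ c k + T l * z k ∧ c k + T l * z k ≤ ⌈c k⌉ := by
    have hf := Int.floor_le (c k)
    have hc := Int.le_ceil (c k)
    rcases lt_trichotomy (z k) 0 with h | h | h
    · have h1 : T l ≤ (⌊c k⌋ - c k) / z k := by simpa [T, g, h.le, not_lt.2 h.le] using hmin k h.ne
      rw [le_div_iff_of_neg h] at h1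
      have := mul_nonpos_of_nonneg_of_nonpos (hT0 l) h.le
      constructor <;> linarith
    · simp [h, hf, hc]
    · have h1 : T l ≤ (⌈c k⌉ - c k) / z k := by simpa [T, g, h] using hmin k h.ne'
      rw [le_div_iff₀ h] at h1
      have := mul_nonneg (hT0 l) h.le
      constructor <;> linarith
  refine ⟨T l, ?_, l, fun h => hl (hcz l h), g l, ?_⟩
  · have : ∑ k, |c k + T l * z k| =
        ∑ k, |c k| + T l * ∑ k, (SignType.sign (c k) : ℚ) * z k := by
      rw [Finset.mul_sum, ← Finset.sum_add_distrib]
      refine Finset.sum_congr rfl fun k _ => ?_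
      rw [abs_eq_of_mem_floor_ceil (hb k).1 (hb k).2]
      ring
    rw [this]
    have := mul_nonpos_of_nonneg_of_nonpos (hT0 l) hs
    linarith
  · simp only [T, div_mul_cancel₀ _ hl, add_sub_cancel]
    rfl

/-- A rational flow with integral divergence can be replaced by an integral flow with the
same divergence and no larger `ℓ¹`-norm. -/
lemma exists_int_flow {d n : ℕ} {v w : Fin n → Fin d} (hne : ∀ k, v k ≠ w k)
    (y : Fin d → ℤ) (c : Fin n → ℚ)
    (hc : ∀ i, ∑ k, (dirEdgeMatrix v w i k : ℚ) * c k = y i) :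
    ∃ f : Fin n → ℤ, (∀ i, ∑ k, dirEdgeMatrix v w i k * f k = y i) ∧
      ((∑ k, |f k| : ℤ) : ℚ) ≤ ∑ k, |c k| := by
  classical
  induction hN : (Finset.univ.filter fun k => c k ∉ intRat).card using Nat.strong_induction_on
    generalizing c with
  | _ N ih =>
    by_cases hex : ∃ k, c k ∉ intRat
    · obtain ⟨z, hz, hcz, hAz⟩ := exists_circulation_of_not_mem_intRat hne c
        (fun i => ⟨y i, by simp [hc]⟩) hex
      obtain ⟨t, ht, l, hl, hl'⟩ := exists_step c z hz hcz
      obtain ⟨f, hf, hfc⟩ := ih _ (by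
        rw [← hN]
        refine Finset.card_lt_card
          (t := Finset.univ.filter fun k => c k ∉ intRat) (Finset.ssubset_iff_of_subset ?_ |>.2
            ⟨l, Finset.mem_filter.2 ⟨Finset.mem_univ _, hl⟩,
              fun h => (Finset.mem_filter.1 h).2 hl'⟩)
        intro k hk
        refine Finset.mem_filter.2 ⟨Finset.mem_univ _, fun h => (Finset.mem_filter.1 hk).2 ?_⟩
        simpa only [hcz k h, mul_zero, add_zero] using h)
        (fun k => c k + t * z k) (fun i => by
          have : ∀ k, (dirEdgeMatrix v w i k : ℚ) * (c k + t * z k) =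
            dirEdgeMatrix v w i k * c k + t * (dirEdgeMatrix v w i k * z k) := fun k => by ring
          simp only [this]
          rw [Finset.sum_add_distrib, ← Finset.mul_sum, hAz, hc]
          simp) rfl
      exact ⟨f, hf, hfc.trans ht⟩
    · push Not at hex
      choose f hf using hex
      have hf' : ∀ k, (f k : ℚ) = c k := hf
      refine ⟨f, fun i => ?_, ?_⟩
      · have := hc i
        simp only [← hf'] at this
        exact_mod_cast this
      · simp [← hf']

section Csc

variable {d n : ℕ}

/-- The column index of `(a_k, 1)` in `A^±`. -/
def posIdx (k : Fin n) : Fin (2 * n + 1) := ⟨k + 1, by omega⟩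

/-- The column index of `(-a_k, 1)` in `A^±`. -/
def negIdx (k : Fin n) : Fin (2 * n + 1) := ⟨n + k + 1, by omega⟩

lemma sum_cscIdx {M : Type*} [AddCommMonoid M] (f : Fin (2 * n + 1) → M) :
    ∑ j, f j = f 0 + (∑ k : Fin n, f (posIdx k) + ∑ k : Fin n, f (negIdx k)) := by
  rw [Fin.sum_univ_succ, ← Equiv.sum_comp (finCongr (two_mul n).symm), Fin.sum_univ_add]
  rfl

variable (A : Matrix (Fin d) (Fin n) ℤ)

lemma csc_last (j : Fin (2 * n + 1)) : csc A (Fin.last d) j = 1 := by simp [csc]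

lemma csc_castSucc_zero (i : Fin d) : csc A i.castSucc 0 = 0 := by simp [csc]

lemma csc_castSucc_posIdx (i : Fin d) (k : Fin n) :
    csc A i.castSucc (posIdx k) = A i k := by
  simp [csc, posIdx]

lemma csc_castSucc_negIdx (i : Fin d) (k : Fin n) :
    csc A i.castSucc (negIdx k) = - A i k := by
  have h : ¬ (n + (k : ℕ) + 1 ≤ n) := by omega
  have h2 : n + (k : ℕ) + 1 - n - 1 = k := by omega
  simp [csc, negIdx, h, h2]

/-- An integral combination of the columns of `A` whose `ℓ¹`-norm is bounded by the last
coordinate lies in the monoid of `A^±`. -/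
lemma mem_colMonoid_csc (x : Fin (d + 1) → ℤ) (f : Fin n → ℤ)
    (hf : ∀ i, ∑ k, A i k * f k = x (Fin.castSucc i))
    (hle : ∑ k, |f k| ≤ x (Fin.last d)) : x ∈ colMonoid (csc A) := by
  have hcol (j) : (fun i => csc A i j) ∈ colMonoid (csc A) :=
    AddSubmonoid.subset_closure ⟨j, rfl⟩
  have hx : x = (x (Fin.last d) - ∑ k, |f k|).toNat • (fun i => csc A i 0) +
      (∑ k, (f k).toNat • (fun i => csc A i (posIdx k)) +
        ∑ k, (-f k).toNat • (fun i => csc A i (negIdx k))) := by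
    ext i
    simp only [Pi.add_apply, Finset.sum_apply, Pi.smul_apply]
    simp only [nsmul_eq_mul]
    rw [← Finset.sum_add_distrib]
    refine Fin.lastCases ?_ (fun i => ?_) i
    · simp only [csc_last, mul_one]
      have (k : Fin n) : ((f k).toNat : ℤ) + ((-f k).toNat : ℤ) = |f k| := by
        rcases abs_cases (f k) with h | h <;> omega
      simp only [this]
      rw [Int.toNat_of_nonneg (by omega)]
      ring
    · simp only [csc_castSucc_zero, csc_castSucc_posIdx, csc_castSucc_negIdx, mul_zero, zero_add]
      rw [← hf]
      refine Finset.sum_congr rfl fun k _ => ?_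
      have : f k = ((f k).toNat : ℤ) - ((-f k).toNat : ℤ) := by omega
      conv_lhs => rw [this]
      ring
  rw [hx]
  exact add_mem (nsmul_mem (hcol _) _) (add_mem (sum_mem fun k _ => nsmul_mem (hcol _) _)
    (sum_mem fun k _ => nsmul_mem (hcol _) _))

/-- A point of the cone of `A^±` is a rational combination of the columns of `A` whose
`ℓ¹`-norm is bounded by the last coordinate. -/
lemma exists_of_mem_colQNonneg_csc {x : Fin (d + 1) → ℤ} (hx : x ∈ colQNonneg (csc A)) :
    ∃ c : Fin n → ℚ, (∀ i, ∑ k, (A i k : ℚ) * c k = x (Fin.castSucc i)) ∧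
      ∑ k, |c k| ≤ x (Fin.last d) := by
  obtain ⟨r, hr, hx⟩ := hx
  refine ⟨fun k => r (posIdx k) - r (negIdx k), fun i => ?_, ?_⟩
  · rw [hx, sum_cscIdx]
    simp only [csc_castSucc_zero, csc_castSucc_posIdx, csc_castSucc_negIdx]
    rw [← Finset.sum_add_distrib]
    simp only [Int.cast_zero, mul_zero, zero_add]
    exact Finset.sum_congr rfl fun k _ => by push_cast; ring
  · rw [hx, sum_cscIdx]
    simp only [csc_last, Int.cast_one, mul_one]
    rw [← Finset.sum_add_distrib]
    have : ∑ k, |r (posIdx k) - r (negIdx k)| ≤ ∑ k : Fin n, (r (posIdx k) + r (negIdx k)) :=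
      Finset.sum_le_sum fun k _ => abs_le.2
        ⟨by linarith [hr (posIdx k)], by linarith [hr (negIdx k)]⟩
    linarith [hr 0]

end Csc

lemma colMonoid_subset {d n : ℕ} (A : Matrix (Fin d) (Fin n) ℤ) :
    (colMonoid A : Set (Fin d → ℤ)) ⊆ (colLattice A : Set (Fin d → ℤ)) ∩ colQNonneg A := by
  classical
  intro x hx
  refine ⟨AddSubgroup.le_closure_toAddSubmonoid _ hx, ?_⟩
  induction hx using AddSubmonoid.closure_induction with
  | mem x hx =>
    obtain ⟨j, rfl⟩ := hx
    exact ⟨Pi.single j 1, fun k => by by_cases h : k = j <;> simp [h],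
      fun i => by simp [Pi.single_apply]⟩
  | zero => exact ⟨0, fun _ => le_rfl, fun i => by simp⟩
  | add x y _ _ hx hy =>
    obtain ⟨r, hr, hx⟩ := hx
    obtain ⟨s, hs, hy⟩ := hy
    exact ⟨r + s, fun j => add_nonneg (hr j) (hs j), fun i => by
      simp [hx, hy, add_mul, Finset.sum_add_distrib]⟩

/-- **Corollary 3.1.** Let `G` be a finite simple connected graph on `{1,…,d}` whose
edges are `e_k = {v k, w k}`, `k = 1,…,n`.  Then the normality condition holds for
the centrally symmetric configuration `(A_{G̃})^±`; i.e. `K[(A_{G̃})^±]` is normal. -/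
theorem csc_dirEdgeMatrix_normal (d n : ℕ) (G : SimpleGraph (Fin d))
    (hG : G.Connected)
    (v w : Fin n → Fin d) (hlt : ∀ k, v k < w k)
    (hadj : ∀ k, G.Adj (v k) (w k))
    (hsurj : ∀ i j : Fin d, G.Adj i j →
      ∃ k, (v k = i ∧ w k = j) ∨ (v k = j ∧ w k = i))
    (hinj : Function.Injective fun k => (v k, w k)) :
    IsNormalConfig (csc (dirEdgeMatrix v w)) := by
  refine Set.Subset.antisymm (colMonoid_subset _) fun x hx => ?_
  obtain ⟨c, hc, hle⟩ := exists_of_mem_colQNonneg_csc _ hx.2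
  obtain ⟨f, hf, hfc⟩ := exists_int_flow (fun k => (hlt k).ne) (fun i => x i.castSucc) c hc
  exact mem_colMonoid_csc _ x f hf (by exact_mod_cast hfc.trans hle)
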